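/- Let H be a real inner product space, let J₊ : H → ℝ and J₋ : H → ℝ with J₋ convex and differentiable at every point with gradient ∇J₋, and set J := J₊ − J₋. Let V ⊆ H be a subspace, τ > 0, L a positive integer, and let u⁰, u¹, …, u^L ∈ V be such that for each k ∈ {1, …, L}, u^k minimizes G_k(v) := (1/(2τ))‖v − u^{k−1}‖² + J₊(v) − ⟨∇J₋(u^{k−1}), v⟩ over V. Then for every ℓ with 1 ≤ ℓ ≤ L, (τ/2) Σ_{k=1}^{ℓ} ‖(u^k − u^{k−1})/τ‖² + J(u^ℓ) ≤ J(u⁰). -/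

import Mathlib

open scoped RealInnerProductSpace BigOperators

/-- The gradient inequality: a convex function lies above its tangent at each point. -/
theorem ConvexOn.add_fderiv_sub_le {E : Type*} [NormedAddCommGroup E] [NormedSpace ℝ E]
    {s : Set E} {f : E → ℝ} {f' : E →L[ℝ] ℝ} {x y : E} (hf : ConvexOn ℝ s f)
    (hx : x ∈ s) (hy : y ∈ s) (hf' : HasFDerivAt f f' x) :
    f x + f' (y - x) ≤ f y := by
  have hline : ConvexOn ℝ (AffineMap.lineMap x y ⁻¹' s : Set ℝ)
      (f ∘ AffineMap.lineMap (k := ℝ) x y) :=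
    hf.comp_affineMap _
  have hderiv : HasDerivAt (f ∘ AffineMap.lineMap (k := ℝ) x y) (f' (y - x)) 0 :=
    HasFDerivAt.comp_hasDerivAt (0 : ℝ) (by simpa using hf') AffineMap.hasDerivAt_lineMap
  have hslope := hline.le_slope_of_hasDerivAt (x := 0) (y := 1) (by simpa using hx)
    (by simpa using hy) one_pos hderiv
  simp only [slope_def_field, Function.comp_apply, AffineMap.lineMap_apply_zero,
    AffineMap.lineMap_apply_one, sub_zero, div_one] at hslope
  linarith

/-- One step of the convex splitting scheme dissipates energy. -/
theorem convex_splitting_step_energy_le {H : Type*} [NormedAddCommGroup H]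
    [InnerProductSpace ℝ H] {Jp Jm : H → ℝ} {g x y : H} {τ : ℝ} (hτ : 0 < τ)
    (hconv : ConvexOn ℝ Set.univ Jm) (hgrad : HasFDerivAt Jm (innerSL ℝ g) x)
    (hmin : 1 / (2 * τ) * ‖y - x‖ ^ 2 + Jp y - ⟪g, y⟫
      ≤ 1 / (2 * τ) * ‖x - x‖ ^ 2 + Jp x - ⟪g, x⟫) :
    τ / 2 * ‖(1 / τ) • (y - x)‖ ^ 2 + (Jp y - Jm y) ≤ Jp x - Jm x := by
  have htangent := hconv.add_fderiv_sub_le (Set.mem_univ x) (Set.mem_univ y) hgrad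
  have hnorm : τ / 2 * ‖(1 / τ) • (y - x)‖ ^ 2 = 1 / (2 * τ) * ‖y - x‖ ^ 2 := by
    rw [norm_smul, mul_pow, Real.norm_eq_abs, sq_abs]
    field_simp
  rw [innerSL_apply_apply, inner_sub_right] at htangent
  simp only [sub_self, norm_zero] at hmin
  rw [hnorm]
  linarith

/-- The discrete energy estimate (7.5) of Theorem 7.1 in abstract form.
Let `H` be a real inner product space, `J = Jp − Jm` with `Jm` convex and
everywhere differentiable with gradient `∇Jm`, `V ⊆ H` a subspace, `τ > 0`,
and let `u⁰, …, u^L ∈ V` be such that each `u^k` (1 ≤ k ≤ L) minimizes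
`G_k(v) = (1/(2τ))‖v − u^{k−1}‖² + Jp(v) − ⟨∇Jm(u^{k−1}), v⟩` over `V`.
Then `(τ/2) Σ_{k=1}^{ℓ} ‖(u^k − u^{k−1})/τ‖² + J(u^ℓ) ≤ J(u⁰)` for
`1 ≤ ℓ ≤ L`. -/
theorem discrete_convex_splitting_energy_estimate
    {H : Type*} [NormedAddCommGroup H] [InnerProductSpace ℝ H]
    (Jp Jm : H → ℝ) (gJm : H → H)
    (hconv : ConvexOn ℝ Set.univ Jm)
    (hgrad : ∀ x : H, HasFDerivAt Jm (innerSL ℝ (gJm x)) x)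
    (V : Submodule ℝ H) (τ : ℝ) (hτ : 0 < τ) (L : ℕ) (hL : 0 < L)
    (u : ℕ → H) (hmem : ∀ k ≤ L, u k ∈ V)
    (hmin : ∀ k, 1 ≤ k → k ≤ L → ∀ v ∈ V,
      1 / (2 * τ) * ‖u k - u (k - 1)‖ ^ 2 + Jp (u k) - ⟪gJm (u (k - 1)), u k⟫
        ≤ 1 / (2 * τ) * ‖v - u (k - 1)‖ ^ 2 + Jp v - ⟪gJm (u (k - 1)), v⟫) :
    ∀ ℓ, 1 ≤ ℓ → ℓ ≤ L →
      τ / 2 * ∑ k ∈ Finset.Icc 1 ℓ, ‖(1 / τ) • (u k - u (k - 1))‖ ^ 2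
          + (Jp (u ℓ) - Jm (u ℓ))
        ≤ Jp (u 0) - Jm (u 0) := by
  intro ℓ _
  induction ℓ with
  | zero => simp
  | succ n ih =>
    intro hnL
    have hstep := convex_splitting_step_energy_le hτ hconv (hgrad (u n))
      (hmin (n + 1) (by omega) hnL (u n) (hmem n (by omega)))
    rcases Nat.eq_zero_or_pos n with rfl | hn
    · simpa using hstep
    · have hprev := ih hn (by omega)
      rw [Finset.sum_Icc_succ_top (by omega), mul_add, Nat.add_sub_cancel]
      linarith
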